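/- arXiv:2209.01243 — 2 statements merged into one kernel-verified Lean document; each statement's English description precedes it below -/
import Mathlib

section
/- Let f ∈ bmo(ℝⁿ) satisfy lim_{β→∞} γ(f,β) = 0, where γ(f,β) := sup{ ⨍_Q |f − f_Q| : dist(Q,0) > β, ℓ(Q) < 1 } + sup{ |f|_Q : dist(Q,0) > β, ℓ(Q) = 1 }. Then lim_{β→∞} [ sup{ |f|_Q : Q a cube with dist(Q,0) > β and ℓ(Q) ≥ 1 } + sup{ |f|_Q : Q a cube with ℓ(Q) ≥ β } ] = 0. -/
open MeasureTheory Metric Filter Topology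

noncomputable section

/-- A closed axis-parallel cube in ℝⁿ: a closed ball in the sup norm with
positive radius (`half` = half the sidelength). -/
structure Cube (n : ℕ) where
  center : Fin n → ℝ
  half : ℝ
  half_pos : 0 < half

namespace Cube

variable {n : ℕ}

/-- The underlying set of a cube. -/
def toSet (Q : Cube n) : Set (Fin n → ℝ) := Metric.closedBall Q.center Q.half

/-- The sidelength ℓ(Q). -/
def side (Q : Cube n) : ℝ := 2 * Q.half

/-- The mean f_Q of f over Q. -/
def avg (Q : Cube n) (f : (Fin n → ℝ) → ℝ) : ℝ := ⨍ x in Q.toSet, f x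

/-- Mean oscillation of f over Q. -/
def osc (Q : Cube n) (f : (Fin n → ℝ) → ℝ) : ℝ := ⨍ x in Q.toSet, |f x - Q.avg f|

/-- The mean |f|_Q of |f| over Q. -/
def avgAbs (Q : Cube n) (f : (Fin n → ℝ) → ℝ) : ℝ := ⨍ x in Q.toSet, |f x|

/-- Distance from the cube to the origin. -/
def distToOrigin (Q : Cube n) : ℝ := Metric.infDist (0 : Fin n → ℝ) Q.toSet

/-- The cube 2Q, concentric with Q and of twice the sidelength. -/
def double (Q : Cube n) : Cube n := ⟨Q.center, 2 * Q.half, mul_pos two_pos Q.half_pos⟩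

end Cube

variable {n : ℕ}

/-- The modulus of mean oscillation ω_U(f,t): the supremum of the mean oscillation
of f over cubes Q ⊆ U of sidelength < t. -/
def omegaOn (U : Set (Fin n → ℝ)) (f : (Fin n → ℝ) → ℝ) (t : ℝ) : ℝ :=
  sSup {r | ∃ Q : Cube n, Q.toSet ⊆ U ∧ Q.side < t ∧ r = Q.osc f}

/-- sup{ |f|_Q : Q ⊆ U, ℓ(Q) ≥ lam }. -/
def bigAvgSup (U : Set (Fin n → ℝ)) (lam : ℝ) (f : (Fin n → ℝ) → ℝ) : ℝ :=
  sSup {r | ∃ Q : Cube n, Q.toSet ⊆ U ∧ lam ≤ Q.side ∧ r = Q.avgAbs f}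

/-- The nonhomogeneous norm ‖f‖_{bmo_lam(U)}. -/
def bmoNorm (U : Set (Fin n → ℝ)) (lam : ℝ) (f : (Fin n → ℝ) → ℝ) : ℝ :=
  omegaOn U f lam + bigAvgSup U lam f

/-- Membership in bmo_lam(U): integrable on every cube in U and finite norm. -/
def MemBmo (U : Set (Fin n → ℝ)) (lam : ℝ) (f : (Fin n → ℝ) → ℝ) : Prop :=
  (∀ Q : Cube n, Q.toSet ⊆ U → IntegrableOn f Q.toSet) ∧
  BddAbove {r | ∃ Q : Cube n, Q.toSet ⊆ U ∧ Q.side < lam ∧ r = Q.osc f} ∧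
  BddAbove {r | ∃ Q : Cube n, Q.toSet ⊆ U ∧ lam ≤ Q.side ∧ r = Q.avgAbs f}

/-- Sarason's vanishing mean oscillation condition: ω_U(f,t) → 0 as t → 0⁺. -/
def VanishSmallOsc (U : Set (Fin n → ℝ)) (f : (Fin n → ℝ) → ℝ) : Prop :=
  Tendsto (fun t => omegaOn U f t) (nhdsWithin 0 (Set.Ioi 0)) (nhds 0)

/-- f is bounded on U. -/
def BoundedOn (U : Set (Fin n → ℝ)) (f : (Fin n → ℝ) → ℝ) : Prop :=
  ∃ M : ℝ, ∀ x ∈ U, |f x| ≤ M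

/-- f is Lipschitz on U. -/
def LipschitzOn (U : Set (Fin n → ℝ)) (f : (Fin n → ℝ) → ℝ) : Prop :=
  ∃ K : NNReal, LipschitzOnWith K f U

/-- dist(supp f, ∂U) > 0. -/
def SuppAway (U : Set (Fin n → ℝ)) (f : (Fin n → ℝ) → ℝ) : Prop :=
  ∃ d > 0, ∀ x ∈ Function.support f, ∀ y ∈ frontier U, d ≤ dist x y

/-- The nonhomogeneous Lipschitz norm ‖f‖_{Lip_b(U)} = ‖f‖_∞ + Lipschitz seminorm. -/
def lipbNorm (U : Set (Fin n → ℝ)) (f : (Fin n → ℝ) → ℝ) : ℝ :=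
  sSup {r | ∃ x ∈ U, r = |f x|} +
  sSup {r | ∃ x ∈ U, ∃ y ∈ U, x ≠ y ∧ r = |f x - f y| / dist x y}

/-- U is a domain: a nonempty open connected subset of ℝⁿ. -/
def IsRealDomain (U : Set (Fin n → ℝ)) : Prop := IsOpen U ∧ IsConnected U

/-- U is an (ε,δ)-domain. -/
def IsEpsDeltaDomain (U : Set (Fin n → ℝ)) (ε δ : ℝ) : Prop :=
  ∀ x ∈ U, ∀ y ∈ U, dist x y < δ →
    ∃ γ : ℝ → (Fin n → ℝ), ContinuousOn γ (Set.Icc 0 1) ∧ γ 0 = x ∧ γ 1 = y ∧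
      (∀ t ∈ Set.Icc (0:ℝ) 1, γ t ∈ U) ∧
      eVariationOn γ (Set.Icc 0 1) ≤ ENNReal.ofReal (ε⁻¹ * dist x y) ∧
      ∀ t ∈ Set.Icc (0:ℝ) 1,
        ε * (dist (γ t) x * dist (γ t) y) / dist x y ≤ Metric.infDist (γ t) (frontier U)

/-- The natural scale λ_{ε,δ} for an (ε,δ)-domain. -/
def lamED (n : ℕ) (ε δ : ℝ) : ℝ := ε ^ 2 * δ / (320 * n * (1 + Real.sqrt n * ε))

/-- d_Ω(x) = dist(x,∂Ω). -/
def distBd (U : Set (Fin n → ℝ)) (x : Fin n → ℝ) : ℝ := Metric.infDist x (frontier U)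

/-- Ω̊_t = {x ∈ Ω : d_Ω(x) ≥ t}. -/
def innerPart (U : Set (Fin n → ℝ)) (t : ℝ) : Set (Fin n → ℝ) :=
  {x ∈ U | t ≤ distBd U x}

/-- f vanishes at infinity in the bmo_lam(U) sense. -/
def VanishAtInfinity (U : Set (Fin n → ℝ)) (lam : ℝ) (f : (Fin n → ℝ) → ℝ) : Prop :=
  Tendsto (fun R => bmoNorm (U \ Metric.closedBall 0 R) lam f) atTop (nhds 0)

/-- f vanishes at the boundary in the bmo_lam(U) sense. -/
def VanishAtBoundary (U : Set (Fin n → ℝ)) (lam : ℝ) (f : (Fin n → ℝ) → ℝ) : Prop :=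
  Tendsto (fun t => bmoNorm (U \ innerPart U t) lam f) (nhdsWithin 0 (Set.Ioi 0)) (nhds 0)

/-- f is in the bmo_lam(U)-closure of the continuous functions with compact support in U. -/
def InCmoClosure (U : Set (Fin n → ℝ)) (lam : ℝ) (f : (Fin n → ℝ) → ℝ) : Prop :=
  ∃ g : ℕ → (Fin n → ℝ) → ℝ,
    (∀ j, Continuous (g j) ∧ HasCompactSupport (g j) ∧ tsupport (g j) ⊆ U) ∧
    Tendsto (fun j => bmoNorm U lam (f - g j)) atTop (nhds 0)

/-- The homogeneous BMO(ℝⁿ) seminorm: sup of mean oscillation over all cubes. -/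
def bmoHNorm (f : (Fin n → ℝ) → ℝ) : ℝ := sSup {r | ∃ Q : Cube n, r = Q.osc f}
namespace Cube

lemma isCompact_toSet (Q : Cube n) : IsCompact Q.toSet := isCompact_closedBall _ _

lemma toSet_nonempty (Q : Cube n) : Q.toSet.Nonempty :=
  ⟨Q.center, mem_closedBall_self Q.half_pos.le⟩

lemma side_pos (Q : Cube n) : 0 < Q.side := mul_pos two_pos Q.half_pos

lemma volume_toSet (Q : Cube n) : volume.real Q.toSet = Q.side ^ n := by
  rw [Measure.real, toSet, Real.volume_pi_closedBall _ Q.half_pos.le, Fintype.card_fin,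
    ENNReal.toReal_ofReal (pow_nonneg (mul_nonneg zero_le_two Q.half_pos.le) _), side]

lemma avgAbs_eq (Q : Cube n) (f : (Fin n → ℝ) → ℝ) :
    Q.avgAbs f = (∫ x in Q.toSet, |f x|) / Q.side ^ n := by
  rw [avgAbs, setAverage_eq, volume_toSet, smul_eq_mul, div_eq_inv_mul]

lemma avgAbs_nonneg (Q : Cube n) (f : (Fin n → ℝ) → ℝ) : 0 ≤ Q.avgAbs f := by
  rw [avgAbs_eq]
  exact div_nonneg (integral_nonneg fun _ => abs_nonneg _) (pow_nonneg Q.side_pos.le _)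

lemma osc_nonneg (Q : Cube n) (f : (Fin n → ℝ) → ℝ) : 0 ≤ Q.osc f := by
  rw [osc, setAverage_eq]
  exact smul_nonneg (inv_nonneg.2 measureReal_nonneg) (integral_nonneg fun _ => abs_nonneg _)

lemma distToOrigin_anti {P Q : Cube n} (h : P.toSet ⊆ Q.toSet) :
    Q.distToOrigin ≤ P.distToOrigin :=
  infDist_le_infDist_of_subset h P.toSet_nonempty

lemma toSet_subset_closedBall_zero {Q : Cube n} {R : ℝ} (h : Q.distToOrigin ≤ R) :
    Q.toSet ⊆ closedBall 0 (R + Q.side) := by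
  obtain ⟨y, hy, hy'⟩ := Q.isCompact_toSet.exists_infDist_eq_dist Q.toSet_nonempty 0
  intro x hx
  have h1 : dist 0 y ≤ R := hy' ▸ h
  have h2 : dist x Q.center ≤ Q.half := hx
  have h3 : dist y Q.center ≤ Q.half := hy
  have h4 := dist_triangle_right x y Q.center
  have h5 := dist_triangle_right x 0 y
  rw [mem_closedBall, side]
  linarith

/-- A cube of sidelength `ℓ ≥ 1` is covered by `(⌊ℓ⌋ + 1) ^ n` unit cubes contained in it. -/
lemma exists_unit_cover (Q : Cube n) (hQ : 1 ≤ Q.side) :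
    ∃ P : (Fin n → Fin (⌊Q.side⌋₊ + 1)) → Cube n,
      (∀ k, (P k).side = 1) ∧ (∀ k, (P k).toSet ⊆ Q.toSet) ∧
        Q.toSet ⊆ ⋃ k, (P k).toSet := by
  rw [side] at hQ
  refine ⟨fun k => ⟨fun i => min (Q.center i - Q.half + ((k i : ℕ) : ℝ))
    (Q.center i + Q.half - 1) + 1 / 2, 1 / 2, by norm_num⟩, fun k => by norm_num [side], ?_, ?_⟩
  · intro k x hx
    rw [toSet, mem_closedBall, dist_pi_le_iff (by norm_num)] at hx
    rw [toSet, mem_closedBall, dist_pi_le_iff Q.half_pos.le]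
    intro i
    have h := hx i
    have hk : (0 : ℝ) ≤ ((k i : ℕ) : ℝ) := Nat.cast_nonneg _
    have h1 := min_le_right (Q.center i - Q.half + ((k i : ℕ) : ℝ)) (Q.center i + Q.half - 1)
    have h2 : Q.center i - Q.half ≤
        min (Q.center i - Q.half + ((k i : ℕ) : ℝ)) (Q.center i + Q.half - 1) :=
      le_min (by linarith) (by linarith)
    rw [Real.dist_eq, abs_le] at h ⊢
    dsimp only at h
    constructor <;> linarith [h.1, h.2]
  · intro x hx
    rw [toSet, mem_closedBall, dist_pi_le_iff Q.half_pos.le] at hx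
    have hx' : ∀ i, 0 ≤ x i - (Q.center i - Q.half) ∧ x i - (Q.center i - Q.half) ≤ Q.side := by
      intro i
      have h := hx i
      rw [Real.dist_eq, abs_le] at h
      rw [side]
      constructor <;> linarith [h.1, h.2]
    refine Set.mem_iUnion.2 ⟨fun i => ⟨⌊x i - (Q.center i - Q.half)⌋₊,
      Nat.lt_succ_of_le (Nat.floor_mono (hx' i).2)⟩, ?_⟩
    rw [toSet, mem_closedBall, dist_pi_le_iff (by norm_num)]
    intro i
    obtain ⟨h1, h2⟩ := hx' i
    have h3 := Nat.floor_le h1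
    have h4 := Nat.lt_floor_add_one (x i - (Q.center i - Q.half))
    rw [side] at h2
    rw [Real.dist_eq, abs_le]
    dsimp only
    rcases min_cases (Q.center i - Q.half + (⌊x i - (Q.center i - Q.half)⌋₊ : ℝ))
      (Q.center i + Q.half - 1) with ⟨h, h'⟩ | ⟨h, h'⟩ <;> rw [h] <;>
      constructor <;> linarith

end Cube

lemma setIntegral_abs_le_of_subset_union {α ι : Type*} [MeasurableSpace α] [Fintype ι]
    {μ : Measure α} {f : α → ℝ} {B S : Set α} {T : ι → Set α} {δ : ℝ} (hδ : 0 ≤ δ)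
    (hB : IntegrableOn f B μ) (hS : IntegrableOn f S μ) (hT : ∀ k, IntegrableOn f (T k) μ)
    (hcov : S ⊆ ⋃ k, T k) (h : ∀ k, T k ⊆ B ∨ ∫ x in T k, |f x| ∂μ ≤ δ) :
    ∫ x in S, |f x| ∂μ ≤ ∫ x in B, |f x| ∂μ + Fintype.card ι * δ := by
  classical
  have key : ∀ {A : Set α}, IntegrableOn f A μ →
      ENNReal.ofReal (∫ x in A, |f x| ∂μ) = ∫⁻ x in A, ‖f x‖ₑ ∂μ := fun hA =>
    ofReal_integral_norm_eq_lintegral_enorm hA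
  have hB0 : 0 ≤ ∫ x in B, |f x| ∂μ := integral_nonneg fun _ => abs_nonneg _
  rw [← ENNReal.ofReal_le_ofReal_iff (by positivity), ENNReal.ofReal_add hB0 (by positivity),
    key hS, key hB]
  let U : ι → Set α := fun k => if T k ⊆ B then ∅ else T k
  have hSU : S ⊆ B ∪ ⋃ k, U k := by
    intro x hx
    obtain ⟨k, hk⟩ := Set.mem_iUnion.1 (hcov hx)
    by_cases hkB : T k ⊆ B
    · exact Or.inl (hkB hk)
    · exact Or.inr (Set.mem_iUnion.2 ⟨k, by simpa [U, hkB] using hk⟩)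
  calc ∫⁻ x in S, ‖f x‖ₑ ∂μ ≤ ∫⁻ x in B ∪ ⋃ k, U k, ‖f x‖ₑ ∂μ := lintegral_mono_set hSU
    _ ≤ ∫⁻ x in B, ‖f x‖ₑ ∂μ + ∫⁻ x in ⋃ k, U k, ‖f x‖ₑ ∂μ := lintegral_union_le _ _ _
    _ ≤ _ := by
      gcongr
      refine (lintegral_iUnion_le _ _).trans ?_
      rw [tsum_fintype, ENNReal.ofReal_mul (Nat.cast_nonneg _), ENNReal.ofReal_natCast,
        ← Finset.card_univ, ← nsmul_eq_mul]
      refine Finset.sum_le_card_nsmul _ _ _ fun k _ => ?_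
      by_cases hkB : T k ⊆ B
      · simp [U, hkB]
      · simp only [U, hkB, if_false]
        rw [← key (hT k)]
        exact ENNReal.ofReal_le_ofReal ((h k).resolve_left hkB)

lemma Cube.avgAbs_le_of_unit_subcubes {f : (Fin n → ℝ) → ℝ} (hf : ∀ Q : Cube n,
    IntegrableOn f Q.toSet) {B : Set (Fin n → ℝ)} (hB : IntegrableOn f B) {δ : ℝ} (hδ : 0 ≤ δ)
    (Q : Cube n) (hQ : 1 ≤ Q.side)
    (h : ∀ P : Cube n, P.side = 1 → P.toSet ⊆ Q.toSet → P.toSet ⊆ B ∨ P.avgAbs f ≤ δ) :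
    Q.avgAbs f ≤ (∫ x in B, |f x|) / Q.side ^ n + 2 ^ n * δ := by
  obtain ⟨P, hP1, hPQ, hcov⟩ := Q.exists_unit_cover hQ
  have hle := setIntegral_abs_le_of_subset_union hδ hB (hf Q) (fun k => hf (P k)) hcov
    (fun k => (h (P k) (hP1 k) (hPQ k)).imp_right fun h' => by
      simpa [avgAbs_eq, hP1 k] using h')
  have hs := Q.side_pos
  have hcard : (Fintype.card (Fin n → Fin (⌊Q.side⌋₊ + 1)) : ℝ) ≤ 2 ^ n * Q.side ^ n := by
    rw [Fintype.card_fun, Fintype.card_fin, Fintype.card_fin, ← mul_pow]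
    push_cast
    have := Nat.floor_le hs.le
    gcongr
    linarith
  rw [avgAbs_eq, div_le_iff₀ (pow_pos hs _), add_mul, div_mul_cancel₀ _ (pow_pos hs _).ne']
  nlinarith [mul_le_mul_of_nonneg_right hcard hδ]

/-- If f ∈ bmo(ℝⁿ) satisfies γ(f,β) → 0 as β → ∞, then the averages |f|_Q over large
cubes far from the origin, and over cubes of sidelength ≥ β, also vanish. -/
theorem stmt9 {n : ℕ} (hn : 0 < n) (f : (Fin n → ℝ) → ℝ)
    (hf : MemBmo (Set.univ : Set (Fin n → ℝ)) 1 f)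
    (hγ : Tendsto (fun β =>
        sSup {r | ∃ Q : Cube n, β < Q.distToOrigin ∧ Q.side < 1 ∧ r = Q.osc f} +
        sSup {r | ∃ Q : Cube n, β < Q.distToOrigin ∧ Q.side = 1 ∧ r = Q.avgAbs f})
      atTop (nhds 0)) :
    Tendsto (fun β =>
        sSup {r | ∃ Q : Cube n, β < Q.distToOrigin ∧ 1 ≤ Q.side ∧ r = Q.avgAbs f} +
        sSup {r | ∃ Q : Cube n, β ≤ Q.side ∧ r = Q.avgAbs f})
      atTop (nhds 0) := by
  obtain ⟨hint', hosc, habs⟩ := hf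
  have hint : ∀ Q : Cube n, IntegrableOn f Q.toSet := fun Q => hint' Q (Set.subset_univ _)
  have unit_small : ∀ δ > 0, ∃ R : ℝ, 0 < R ∧
      ∀ Q : Cube n, R < Q.distToOrigin → Q.side = 1 → Q.avgAbs f ≤ δ := by
    intro δ hδ
    obtain ⟨R, hR, hR0⟩ := ((hγ.eventually_lt_const hδ).and (eventually_gt_atTop 0)).exists
    refine ⟨R, hR0, fun Q hQ hQ1 => ?_⟩
    have h1 : Q.avgAbs f ≤
        sSup {r | ∃ Q : Cube n, R < Q.distToOrigin ∧ Q.side = 1 ∧ r = Q.avgAbs f} := by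
      refine le_csSup (habs.mono ?_) ⟨Q, hQ, hQ1, rfl⟩
      rintro r ⟨P, -, hP, rfl⟩
      exact ⟨P, Set.subset_univ _, hP.ge, rfl⟩
    have h2 : 0 ≤ sSup {r | ∃ Q : Cube n, R < Q.distToOrigin ∧ Q.side < 1 ∧ r = Q.osc f} := by
      apply Real.sSup_nonneg
      rintro r ⟨P, -, -, rfl⟩
      exact P.osc_nonneg f
    linarith
  have nonneg_far : ∀ β : ℝ,
      0 ≤ sSup {r | ∃ Q : Cube n, β < Q.distToOrigin ∧ 1 ≤ Q.side ∧ r = Q.avgAbs f} := by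
    intro β
    apply Real.sSup_nonneg
    rintro r ⟨P, -, -, rfl⟩
    exact P.avgAbs_nonneg f
  have nonneg_large : ∀ β : ℝ, 0 ≤ sSup {r | ∃ Q : Cube n, β ≤ Q.side ∧ r = Q.avgAbs f} := by
    intro β
    apply Real.sSup_nonneg
    rintro r ⟨P, -, rfl⟩
    exact P.avgAbs_nonneg f
  rw [tendsto_order]
  refine ⟨fun a ha => Eventually.of_forall fun β =>
    ha.trans_le (add_nonneg (nonneg_far β) (nonneg_large β)), fun ε hε => ?_⟩
  have hδ : 0 < ε / (4 * 2 ^ n) := by positivity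
  have hδ' : 2 ^ n * (ε / (4 * 2 ^ n)) = ε / 4 := by field_simp
  obtain ⟨R, hR0, hR⟩ := unit_small _ hδ
  let B : Cube n := ⟨0, R + 1, by linarith⟩
  have hC : 0 ≤ ∫ x in B.toSet, |f x| := integral_nonneg fun _ => abs_nonneg _
  filter_upwards [eventually_ge_atTop R, eventually_ge_atTop 1,
    (tendsto_const_nhds (x := ∫ x in B.toSet, |f x|)).div_atTop tendsto_id |>.eventually_lt_const
      (by positivity : (0 : ℝ) < ε / 4)] with β hβR hβ1 hβC
  have h1 : sSup {r | ∃ Q : Cube n, β < Q.distToOrigin ∧ 1 ≤ Q.side ∧ r = Q.avgAbs f} ≤ ε / 4 := by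
    refine Real.sSup_le ?_ (by positivity)
    rintro r ⟨Q, hQ, hQ1, rfl⟩
    have := Q.avgAbs_le_of_unit_subcubes hint (B := ∅) integrableOn_empty hδ.le hQ1
      fun P hP hPQ => Or.inr (hR P (by linarith [Cube.distToOrigin_anti hPQ]) hP)
    simpa [hδ'] using this
  have h2 : sSup {r | ∃ Q : Cube n, β ≤ Q.side ∧ r = Q.avgAbs f} ≤ ε / 2 := by
    refine Real.sSup_le ?_ (by positivity)
    rintro r ⟨Q, hQ, rfl⟩
    have hQ1 : 1 ≤ Q.side := hβ1.trans hQ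
    have := Q.avgAbs_le_of_unit_subcubes hint (hint B) hδ.le hQ1
      fun P hP _ => (le_or_gt P.distToOrigin R).imp
        (fun h => by simpa [hP, B, Cube.toSet] using Cube.toSet_subset_closedBall_zero h)
        (fun h => hR P h hP)
    have hpow : β ≤ Q.side ^ n := hQ.trans (le_self_pow₀ hQ1 hn.ne')
    have := div_le_div_of_nonneg_left hC (by linarith) hpow
    simp only [id] at hβC
    linarith
  linarith
end
end

section
/- Let Ω ⊂ ℝⁿ be a domain, λ > 0, and f ∈ bmo_λ(Ω). Suppose f vanishes at the boundary, i.e., lim_{t→0⁺} ‖f‖_{bmo_λ(Ω ∖ Ω̊_t)} = 0, and suppose there exists a function φ_λ : (0, λ/2) → (0,∞) with φ_λ(t) = 1 for t ≥ λ/4, with t ↦ t·φ_λ(t) monotone increasing, with ∫₀^{λ/4} dt/(t·φ_λ(t)) = ∞, and a constant C such that |f_Q| ≤ C·φ_λ(ℓ(Q)) for every cube Q with 2Q ⊂ Ω and dist(Q, ∂Ω) < λ/4 (here 2Q is the cube concentric with Q of sidelength 2ℓ(Q)). Then there exists a sequence f_j converging to f in the ‖·‖_{bmo_λ(Ω)}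 norm with dist(supp f_j, ∂Ω) > 0 for each j. -/
open MeasureTheory Metric Filter Topology

noncomputable section

variable {n : ℕ}

section CubeAverages

lemma measureReal_closedBall (c : Fin n → ℝ) {r : ℝ} (hr : 0 ≤ r) :
    volume.real (closedBall c r) = (2 * r) ^ n := by
  rw [Measure.real, Real.volume_pi_closedBall c hr, ENNReal.toReal_ofReal (by positivity),
    Fintype.card_fin]

lemma average_closedBall_eq (c : Fin n → ℝ) {r : ℝ} (hr : 0 ≤ r) (g : (Fin n → ℝ) → ℝ) :
    ⨍ x in closedBall c r, g x = ((2 * r) ^ n)⁻¹ * ∫ x in closedBall c r, g x := by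
  rw [setAverage_eq, measureReal_closedBall c hr, smul_eq_mul]

lemma average_closedBall_const (c : Fin n → ℝ) {r : ℝ} (hr : 0 < r) (a : ℝ) :
    ⨍ _x in closedBall c r, a = a :=
  setAverage_const (measure_closedBall_pos volume c hr).ne' measure_closedBall_lt_top.ne a

lemma integrableOn_closedBall_const (c : Fin n → ℝ) (r a : ℝ) :
    IntegrableOn (fun _ => a) (closedBall c r) :=
  integrableOn_const measure_closedBall_lt_top.ne

lemma average_closedBall_mono {c : Fin n → ℝ} {r : ℝ} (hr : 0 ≤ r) {g h : (Fin n → ℝ) → ℝ}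
    (hg : IntegrableOn g (closedBall c r)) (hh : IntegrableOn h (closedBall c r))
    (hgh : ∀ x ∈ closedBall c r, g x ≤ h x) :
    ⨍ x in closedBall c r, g x ≤ ⨍ x in closedBall c r, h x := by
  rw [average_closedBall_eq c hr, average_closedBall_eq c hr]
  exact mul_le_mul_of_nonneg_left (setIntegral_mono_on hg hh measurableSet_closedBall hgh)
    (by positivity)

lemma average_closedBall_add {c : Fin n → ℝ} {r : ℝ} (hr : 0 ≤ r) {g h : (Fin n → ℝ) → ℝ}
    (hg : IntegrableOn g (closedBall c r)) (hh : IntegrableOn h (closedBall c r)) :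
    ⨍ x in closedBall c r, (g x + h x)
      = (⨍ x in closedBall c r, g x) + ⨍ x in closedBall c r, h x := by
  simp only [average_closedBall_eq c hr]
  rw [integral_add hg hh, mul_add]

lemma average_closedBall_sub {c : Fin n → ℝ} {r : ℝ} (hr : 0 ≤ r) {g h : (Fin n → ℝ) → ℝ}
    (hg : IntegrableOn g (closedBall c r)) (hh : IntegrableOn h (closedBall c r)) :
    ⨍ x in closedBall c r, (g x - h x)
      = (⨍ x in closedBall c r, g x) - ⨍ x in closedBall c r, h x := by
  simp only [average_closedBall_eq c hr]
  rw [integral_sub hg hh, mul_sub]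

lemma average_closedBall_nonneg {c : Fin n → ℝ} {r : ℝ} (hr : 0 ≤ r) {g : (Fin n → ℝ) → ℝ}
    (hg : ∀ x, 0 ≤ g x) : 0 ≤ ⨍ x in closedBall c r, g x := by
  rw [average_closedBall_eq c hr]
  exact mul_nonneg (by positivity) (integral_nonneg hg)

lemma integrableOn_abs_sub {c : Fin n → ℝ} {r : ℝ} {g : (Fin n → ℝ) → ℝ}
    (hg : IntegrableOn g (closedBall c r)) (a : ℝ) :
    IntegrableOn (fun x => |g x - a|) (closedBall c r) :=
  (hg.sub (integrableOn_closedBall_const c r a)).abs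

lemma abs_average_closedBall_sub_le {c : Fin n → ℝ} {r : ℝ} (hr : 0 < r)
    {g : (Fin n → ℝ) → ℝ} (hg : IntegrableOn g (closedBall c r)) (a : ℝ) :
    |(⨍ x in closedBall c r, g x) - a| ≤ ⨍ x in closedBall c r, |g x - a| := by
  have h := average_closedBall_sub hr.le hg (integrableOn_closedBall_const c r a)
  rw [average_closedBall_const c hr] at h
  rw [← h, average_closedBall_eq c hr.le, average_closedBall_eq c hr.le, abs_mul,
    abs_of_nonneg (by positivity : (0 : ℝ) ≤ ((2 * r) ^ n)⁻¹)]
  exact mul_le_mul_of_nonneg_left abs_integral_le_integral_abs (by positivity)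

/-- The mean oscillation is at most the mean distance to a given constant, up to changing
the constant. -/
lemma average_abs_sub_le_add {c : Fin n → ℝ} {r : ℝ} (hr : 0 < r)
    {g : (Fin n → ℝ) → ℝ} (hg : IntegrableOn g (closedBall c r)) (a b : ℝ) :
    ⨍ x in closedBall c r, |g x - b| ≤ (⨍ x in closedBall c r, |g x - a|) + |a - b| := by
  have h := average_closedBall_add hr.le (integrableOn_abs_sub hg a)
    (integrableOn_closedBall_const c r |a - b|)
  rw [average_closedBall_const c hr] at h
  rw [← h]
  exact average_closedBall_mono hr.le (integrableOn_abs_sub hg b)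
    ((integrableOn_abs_sub hg a).add (integrableOn_closedBall_const c r _))
    fun x _ => abs_sub_le _ _ _

lemma average_abs_sub_average_le {c : Fin n → ℝ} {r : ℝ} (hr : 0 < r)
    {g : (Fin n → ℝ) → ℝ} (hg : IntegrableOn g (closedBall c r)) (a : ℝ) :
    ⨍ x in closedBall c r, |g x - ⨍ y in closedBall c r, g y|
      ≤ 2 * ⨍ x in closedBall c r, |g x - a| := by
  have h₁ := average_abs_sub_le_add hr hg a (⨍ y in closedBall c r, g y)
  have h₂ := abs_average_closedBall_sub_le hr hg a
  rw [abs_sub_comm] at h₂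
  linarith

lemma average_closedBall_le_of_subset {c c' : Fin n → ℝ} {r s : ℝ} (hs : 0 < s) (hr : 0 < r)
    {g : (Fin n → ℝ) → ℝ} (hsub : closedBall c' s ⊆ closedBall c r)
    (hg : IntegrableOn g (closedBall c r)) (h0 : ∀ x, 0 ≤ g x) :
    ⨍ x in closedBall c' s, g x ≤ (r / s) ^ n * ⨍ x in closedBall c r, g x := by
  rw [average_closedBall_eq c hr.le, average_closedBall_eq c' hs.le, ← mul_assoc]
  have : (r / s) ^ n * ((2 * r) ^ n)⁻¹ = ((2 * s) ^ n)⁻¹ := by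
    rw [← inv_pow, ← inv_pow, ← mul_pow]; congr 1; field_simp
  rw [this]
  refine mul_le_mul_of_nonneg_left ?_ (by positivity)
  exact setIntegral_mono_set hg (Eventually.of_forall h0) hsub.eventuallyLE

lemma abs_average_sub_average_le {c c' : Fin n → ℝ} {r s : ℝ} (hs : 0 < s) (hr : 0 < r)
    {g : (Fin n → ℝ) → ℝ} (hsub : closedBall c' s ⊆ closedBall c r)
    (hg : IntegrableOn g (closedBall c r)) (a : ℝ) :
    |(⨍ x in closedBall c' s, g x) - a| ≤ (r / s) ^ n * ⨍ x in closedBall c r, |g x - a| :=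
  (abs_average_closedBall_sub_le hs (hg.mono_set hsub) a).trans
    (average_closedBall_le_of_subset hs hr hsub (integrableOn_abs_sub hg a) fun _ => abs_nonneg _)

/-- The center of the subcube with index `v` in the subdivision of a cube into `3 ^ n`
congruent subcubes. -/
def subcubeCenter (c : Fin n → ℝ) (r : ℝ) (v : Fin n → Fin 3) : Fin n → ℝ :=
  fun i => c i + 2 * r / 3 * (((v i : ℕ) : ℝ) - 1)

lemma dist_subcubeCenter_le (c : Fin n → ℝ) {r : ℝ} (hr : 0 ≤ r) (v : Fin n → Fin 3) :
    dist (subcubeCenter c r v) c ≤ 2 * r / 3 := by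
  refine (dist_pi_le_iff (by positivity)).2 fun i => ?_
  rw [Real.dist_eq, subcubeCenter, add_sub_cancel_left, abs_mul,
    abs_of_nonneg (by positivity : 0 ≤ 2 * r / 3)]
  refine mul_le_of_le_one_right (by positivity) ?_
  generalize v i = k
  fin_cases k <;> norm_num

lemma subcubeCenter_one (c : Fin n → ℝ) (r : ℝ) : subcubeCenter c r (fun _ => 1) = c := by
  ext i; simp [subcubeCenter]

lemma subcube_subset (c : Fin n → ℝ) {r : ℝ} (hr : 0 ≤ r) (v : Fin n → Fin 3) :
    closedBall (subcubeCenter c r v) (r / 3) ⊆ closedBall c r :=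
  closedBall_subset_closedBall' (by linarith [dist_subcubeCenter_le c hr v])

lemma subset_iUnion_subcube (c : Fin n → ℝ) {r : ℝ} (hr : 0 ≤ r) :
    closedBall c r ⊆ ⋃ v : Fin n → Fin 3, closedBall (subcubeCenter c r v) (r / 3) := by
  intro x hx
  have hx' := (dist_pi_le_iff hr).1 hx
  have : ∀ i, ∃ k : Fin 3, |x i - (c i + 2 * r / 3 * (((k : ℕ) : ℝ) - 1))| ≤ r / 3 := by
    intro i
    have h := abs_le.1 (hx' i)
    rcases le_total (x i - c i) (-(r / 3)) with h1 | h1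
    · exact ⟨0, abs_le.2 ⟨by simp; linarith, by simp; linarith⟩⟩
    rcases le_total (x i - c i) (r / 3) with h2 | h2
    · exact ⟨1, abs_le.2 ⟨by simp; linarith, by simp; linarith⟩⟩
    · exact ⟨2, abs_le.2 ⟨by norm_num; linarith, by norm_num; linarith⟩⟩
  choose v hv using this
  exact Set.mem_iUnion.2 ⟨v, (dist_pi_le_iff (by positivity)).2 hv⟩

lemma average_closedBall_le_sum_subcube (c : Fin n → ℝ) {r : ℝ} (hr : 0 < r)
    {g : (Fin n → ℝ) → ℝ} (hg : IntegrableOn g (closedBall c r)) (h0 : ∀ x, 0 ≤ g x) :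
    ⨍ x in closedBall c r, g x ≤ ((3 : ℝ) ^ n)⁻¹ *
      ∑ v : Fin n → Fin 3, ⨍ x in closedBall (subcubeCenter c r v) (r / 3), g x := by
  have hint : ∀ v, IntegrableOn g (closedBall (subcubeCenter c r v) (r / 3)) :=
    fun v => hg.mono_set (subcube_subset c hr.le v)
  have key : ∫ x in closedBall c r, g x ≤
      ∑ v : Fin n → Fin 3, ∫ x in closedBall (subcubeCenter c r v) (r / 3), g x := by
    rw [← integral_finsetSum_measure fun v _ => hint v]
    refine integral_mono_measure ?_ (Eventually.of_forall h0)
      (integrable_finsetSum_measure.2 fun v _ => hint v)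
    rw [← Measure.sum_fintype]
    exact (Measure.restrict_mono_set _ (subset_iUnion_subcube c hr.le)).trans
      Measure.restrict_iUnion_le
  have hsum : ∑ v : Fin n → Fin 3, ⨍ x in closedBall (subcubeCenter c r v) (r / 3), g x =
      ((2 * (r / 3)) ^ n)⁻¹ *
        ∑ v : Fin n → Fin 3, ∫ x in closedBall (subcubeCenter c r v) (r / 3), g x := by
    rw [Finset.mul_sum]
    exact Finset.sum_congr rfl fun v _ => average_closedBall_eq _ (by positivity) _
  have hcoef : ((3 : ℝ) ^ n)⁻¹ * ((2 * (r / 3)) ^ n)⁻¹ = ((2 * r) ^ n)⁻¹ := by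
    rw [← inv_pow, ← inv_pow, ← inv_pow, ← mul_pow]; congr 1; field_simp
  rw [hsum, ← mul_assoc, hcoef, average_closedBall_eq c hr.le]
  exact mul_le_mul_of_nonneg_left key (by positivity)

end CubeAverages

section LocalToGlobal

/-- `g` is integrable on the closed cubes contained in `U`, and its mean oscillation is at most
`ε` on each cube whose concentric triple is contained in `U`. -/
structure LocalOscLE (U : Set (Fin n → ℝ)) (g : (Fin n → ℝ) → ℝ) (ε : ℝ) : Prop where
  integrableOn : ∀ c r, 0 < r → closedBall c r ⊆ U → IntegrableOn g (closedBall c r)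
  osc_le : ∀ c r, 0 < r → closedBall c (3 * r) ⊆ U →
    ⨍ x in closedBall c r, |g x - ⨍ y in closedBall c r, g y| ≤ ε

namespace LocalOscLE

variable {U : Set (Fin n → ℝ)} {g : (Fin n → ℝ) → ℝ} {ε : ℝ}

lemma abs_average_sub_le (h : LocalOscLE U g ε) {c c' : Fin n → ℝ} {r s : ℝ} (hs : 0 < s)
    (hr : 0 < r) (hsub : closedBall c' s ⊆ closedBall c r) (hU : closedBall c (3 * r) ⊆ U) :
    |(⨍ x in closedBall c' s, g x) - ⨍ x in closedBall c r, g x| ≤ (r / s) ^ n * ε :=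
  (abs_average_sub_average_le hs hr hsub (h.integrableOn c r hr
    ((closedBall_subset_closedBall (by linarith)).trans hU)) _).trans
    (mul_le_mul_of_nonneg_left (h.osc_le c r hr hU) (by positivity))

/-- Averages over small cubes deep inside a cube are comparable to the average over its core. -/
lemma abs_average_core_sub_le (h : LocalOscLE U g ε) {c c' : Fin n → ℝ} {r : ℝ} (hr : 0 < r)
    (hU : closedBall c r ⊆ U) (hc : dist c' c ≤ 2 * r / 3) :
    |(⨍ x in closedBall c' (r / 18), g x) - ⨍ x in closedBall c (r / 6), g x|
      ≤ (3 ^ n + 24 * 2 ^ n) * ε := by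
  have hdist : ∀ t : ℝ, 0 ≤ t → dist (AffineMap.lineMap c c' t) c ≤ t * (2 * r / 3) := by
    intro t ht
    rw [dist_lineMap_left, Real.norm_eq_abs, abs_of_nonneg ht, dist_comm]
    exact mul_le_mul_of_nonneg_left hc ht
  have chain : ∀ i : ℕ, i ≤ 12 →
      |(⨍ x in closedBall (AffineMap.lineMap c c' ((i : ℝ) / 12)) (r / 18), g x)
        - ⨍ x in closedBall c (r / 6), g x| ≤ (3 ^ n + i * (2 * 2 ^ n)) * ε := by
    intro i
    induction i with
    | zero =>
      intro _
      have := h.abs_average_sub_le (c := c) (c' := c) (s := r / 18) (r := r / 6) (by positivity)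
        (by positivity) (closedBall_subset_closedBall (by linarith))
        ((closedBall_subset_closedBall (by linarith)).trans hU)
      rw [show r / 6 / (r / 18) = 3 by field_simp; norm_num] at this
      simpa using this
    | succ i ih =>
      intro hi
      have ih := ih (by omega)
      have hi' : ((i : ℝ)) / 12 ≤ 1 := by
        rw [div_le_one (by norm_num)]; exact_mod_cast (by omega : i ≤ 12)
      set p := AffineMap.lineMap c c' ((i : ℝ) / 12) with hp
      set q := AffineMap.lineMap c c' (((i + 1 : ℕ) : ℝ) / 12) with hq
      have hpc : dist p c ≤ 2 * r / 3 :=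
        (hdist _ (by positivity)).trans (mul_le_of_le_one_left (by positivity) hi')
      have hqp : dist q p ≤ r / 18 := by
        rw [hp, hq, dist_lineMap_lineMap, Real.dist_eq]
        have : ((i + 1 : ℕ) : ℝ) / 12 - (i : ℝ) / 12 = 1 / 12 := by push_cast; ring
        rw [this, abs_of_pos (by norm_num), dist_comm]
        linarith
      have hU' : closedBall p (3 * (r / 9)) ⊆ U :=
        (closedBall_subset_closedBall' (by linarith)).trans hU
      have h₁ := h.abs_average_sub_le (c := p) (c' := p) (s := r / 18) (r := r / 9)
        (by positivity) (by positivity) (closedBall_subset_closedBall (by linarith)) hU'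
      have h₂ := h.abs_average_sub_le (c := p) (c' := q) (s := r / 18) (r := r / 9)
        (by positivity) (by positivity) (closedBall_subset_closedBall' (by linarith)) hU'
      rw [show r / 9 / (r / 18) = 2 by field_simp; norm_num] at h₁ h₂
      rw [abs_le] at *
      push_cast
      constructor <;> linarith [h₁.1, h₁.2, h₂.1, h₂.2, ih.1, ih.2]
  have := chain 12 le_rfl
  norm_num at this
  refine this.trans (le_of_eq (by ring))

lemma nonneg (h : LocalOscLE U g ε) {c : Fin n → ℝ} {r : ℝ} (hr : 0 < r)
    (hU : closedBall c r ⊆ U) : 0 ≤ ε :=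
  (average_closedBall_nonneg (by positivity) fun _ => abs_nonneg _).trans
    (h.osc_le c (r / 3) (by positivity) (by rwa [mul_div_cancel₀ _ (by norm_num)]))

/-- One step of the subdivision argument. -/
lemma average_abs_sub_core_le_of_forall (h : LocalOscLE U g ε) {S : ℝ}
    (hS : ∀ c r, 0 < r → closedBall c r ⊆ U →
      ⨍ x in closedBall c r, |g x - ⨍ y in closedBall c (r / 6), g y| ≤ S)
    {c : Fin n → ℝ} {r : ℝ} (hr : 0 < r) (hU : closedBall c r ⊆ U) :
    ⨍ x in closedBall c r, |g x - ⨍ y in closedBall c (r / 6), g y| ≤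
      (1 - (3 ^ n)⁻¹) * S + (1 + 6 ^ n + 3 ^ n + 24 * 2 ^ n) * ε := by
  have hε := h.nonneg hr hU
  set a := ⨍ y in closedBall c (r / 6), g y with ha
  have hint := h.integrableOn c r hr hU
  have step : ∀ v : Fin n → Fin 3,
      ⨍ x in closedBall (subcubeCenter c r v) (r / 3), |g x - a| ≤
        (if v = fun _ => 1 then (1 + 6 ^ n) * ε else S) + (3 ^ n + 24 * 2 ^ n) * ε := by
    intro v
    have hd := dist_subcubeCenter_le c hr.le v
    have hsub := subcube_subset c hr.le v
    have h₁ := average_abs_sub_le_add (by positivity : 0 < r / 3) (hint.mono_set hsub)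
      (⨍ y in closedBall (subcubeCenter c r v) (r / 18), g y) a
    have h₂ := h.abs_average_core_sub_le hr hU hd
    refine h₁.trans (add_le_add ?_ h₂)
    split_ifs with hv
    · subst hv
      rw [subcubeCenter_one]
      have hU' : closedBall c (3 * (r / 3)) ⊆ U := by
        rwa [mul_div_cancel₀ _ (by norm_num)]
      have h₃ := average_abs_sub_le_add (by positivity : 0 < r / 3)
        (hint.mono_set (closedBall_subset_closedBall (by linarith : r / 3 ≤ r)))
        (⨍ y in closedBall c (r / 3), g y) (⨍ y in closedBall c (r / 18), g y)
      have h₄ := h.abs_average_sub_le (c := c) (c' := c) (s := r / 18) (r := r / 3)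
        (by positivity) (by positivity) (closedBall_subset_closedBall (by linarith)) hU'
      rw [show r / 3 / (r / 18) = 6 by field_simp; norm_num, abs_sub_comm] at h₄
      have h₅ := h.osc_le c (r / 3) (by positivity) hU'
      linarith
    · have := hS (subcubeCenter c r v) (r / 3) (by positivity) (hsub.trans hU)
      rwa [show r / 3 / 6 = r / 18 by ring] at this
  have hsum := (average_closedBall_le_sum_subcube c hr (integrableOn_abs_sub hint a)
    fun _ => abs_nonneg _).trans
    (mul_le_mul_of_nonneg_left (Finset.sum_le_sum fun v _ => step v) (by positivity))
  have hcard : ∑ v : Fin n → Fin 3,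
      ((if v = fun _ => 1 then (1 + 6 ^ n) * ε else S) + (3 ^ n + 24 * 2 ^ n) * ε)
      = (1 + 6 ^ n) * ε + (3 ^ n - 1) * S + 3 ^ n * ((3 ^ n + 24 * 2 ^ n) * ε) := by
    have : ∀ v : Fin n → Fin 3, (if v = fun _ => 1 then (1 + 6 ^ n) * ε else S)
        = (if v = fun _ => 1 then ((1 + 6 ^ n) * ε - S) else 0) + S := by
      intro v; split_ifs <;> ring
    simp only [this, Finset.sum_add_distrib, Finset.sum_ite_eq', Finset.mem_univ, if_true,
      Finset.sum_const, Finset.card_univ, Fintype.card_pi_const, Fintype.card_fin, nsmul_eq_mul]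
    push_cast
    ring
  rw [hcard] at hsum
  have h3 : (1 : ℝ) ≤ 3 ^ n := one_le_pow₀ (by norm_num)
  have h3' : ((3 : ℝ) ^ n)⁻¹ ≤ 1 := inv_le_one_of_one_le₀ h3
  have e : ((3 : ℝ) ^ n)⁻¹ *
      ((1 + 6 ^ n) * ε + (3 ^ n - 1) * S + 3 ^ n * ((3 ^ n + 24 * 2 ^ n) * ε))
      = ((3 : ℝ) ^ n)⁻¹ * ((1 + 6 ^ n) * ε) + (1 - ((3 : ℝ) ^ n)⁻¹) * S
        + (3 ^ n + 24 * 2 ^ n) * ε := by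
    field_simp
  have : ((3 : ℝ) ^ n)⁻¹ * ((1 + 6 ^ n) * ε) ≤ (1 + 6 ^ n) * ε :=
    mul_le_of_le_one_left (by positivity) h3'
  linarith

end LocalOscLE

/-- The constant of the local-to-global principle. -/
def localToGlobalConst (n : ℕ) : ℝ := 3 ^ n * (1 + 6 ^ n + 3 ^ n + 24 * 2 ^ n)

lemma localToGlobalConst_pos (n : ℕ) : 0 < localToGlobalConst n := by
  unfold localToGlobalConst; positivity

namespace LocalOscLE

variable {U : Set (Fin n → ℝ)} {g : (Fin n → ℝ) → ℝ} {ε : ℝ}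

lemma average_abs_sub_core_le_of_bounded (h : LocalOscLE U g ε) {M : ℝ}
    (hM : ∀ x, |g x| ≤ M) {c : Fin n → ℝ} {r : ℝ} (hr : 0 < r) (hU : closedBall c r ⊆ U) :
    ⨍ x in closedBall c r, |g x - ⨍ y in closedBall c (r / 6), g y|
      ≤ localToGlobalConst n * ε := by
  set A : Set ℝ := {t | ∃ c r, 0 < r ∧ closedBall c r ⊆ U ∧
    t = ⨍ x in closedBall c r, |g x - ⨍ y in closedBall c (r / 6), g y|} with hA
  have hbdd : BddAbove A := by
    refine ⟨M + M, ?_⟩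
    rintro t ⟨c, r, hr, hU, rfl⟩
    have hint := h.integrableOn c r hr hU
    have hcore : |(⨍ y in closedBall c (r / 6), g y) - 0| ≤ M := by
      refine (abs_average_closedBall_sub_le (by positivity) (hint.mono_set
        (closedBall_subset_closedBall (by linarith))) 0).trans ?_
      have := average_closedBall_mono (by positivity) (integrableOn_abs_sub (hint.mono_set
        (closedBall_subset_closedBall (by linarith : r / 6 ≤ r))) 0)
        (integrableOn_closedBall_const c (r / 6) M) (fun x _ => by simpa using hM x)
      rwa [average_closedBall_const c (by positivity)] at this
    rw [sub_zero] at hcore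
    have := average_closedBall_mono hr.le (integrableOn_abs_sub hint _)
      (integrableOn_closedBall_const c r (M + M))
      (fun x _ => (abs_sub _ _).trans (add_le_add (hM x) hcore))
    rwa [average_closedBall_const c hr] at this
  have hle : ∀ c r, 0 < r → closedBall c r ⊆ U →
      ⨍ x in closedBall c r, |g x - ⨍ y in closedBall c (r / 6), g y| ≤ sSup A :=
    fun c r hr hU => le_csSup hbdd ⟨c, r, hr, hU, rfl⟩
  have hS : sSup A ≤ (1 - (3 ^ n)⁻¹) * sSup A + (1 + 6 ^ n + 3 ^ n + 24 * 2 ^ n) * ε := by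
    refine csSup_le ⟨_, c, r, hr, hU, rfl⟩ ?_
    rintro t ⟨c, r, hr, hU, rfl⟩
    exact h.average_abs_sub_core_le_of_forall hle hr hU
  have h3 : (0 : ℝ) < 3 ^ n := by positivity
  have : ((3 : ℝ) ^ n)⁻¹ * sSup A ≤ (1 + 6 ^ n + 3 ^ n + 24 * 2 ^ n) * ε := by linarith
  rw [inv_mul_le_iff₀ h3] at this
  refine (hle c r hr hU).trans (this.trans (le_of_eq ?_))
  rw [localToGlobalConst]; ring

/-- Clamping `g` to `[-M, M]` at most doubles the local mean oscillation. -/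
lemma clamp (h : LocalOscLE U g ε) {M : ℝ} (hM : 0 ≤ M) :
    LocalOscLE U (fun x => (Set.projIcc (-M) M (by linarith) (g x) : ℝ)) (2 * ε) := by
  have hint : ∀ c r, 0 < r → closedBall c r ⊆ U →
      IntegrableOn (fun x => (Set.projIcc (-M) M (by linarith) (g x) : ℝ)) (closedBall c r) := by
    intro c r hr hU
    refine Integrable.mono' (integrableOn_closedBall_const c r M) ?_ ?_
    · exact (continuous_subtype_val.comp continuous_projIcc).comp_aestronglyMeasurable
        (h.integrableOn c r hr hU).aestronglyMeasurable
    · exact Eventually.of_forall fun x => abs_le.2 (Set.projIcc (-M) M (by linarith) (g x)).2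
  refine ⟨hint, fun c r hr hU => ?_⟩
  have hU' : closedBall c r ⊆ U := (closedBall_subset_closedBall (by linarith)).trans hU
  refine (average_abs_sub_average_le hr (hint c r hr hU')
    (Set.projIcc (-M) M (by linarith) (⨍ y in closedBall c r, g y) : ℝ)).trans
    (mul_le_mul_of_nonneg_left ?_ (by norm_num))
  refine le_trans ?_ (h.osc_le c r hr hU)
  exact average_closedBall_mono hr.le (integrableOn_abs_sub (hint c r hr hU') _)
    (integrableOn_abs_sub (h.integrableOn c r hr hU') _)
    fun x _ => Set.abs_projIcc_sub_projIcc _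

/-- **Local-to-global principle**: small oscillation on cubes whose triple lies in `U` implies
small oscillation on every cube in `U`. -/
theorem average_abs_sub_core_le (h : LocalOscLE U g ε) {c : Fin n → ℝ} {r : ℝ} (hr : 0 < r)
    (hU : closedBall c r ⊆ U) :
    ⨍ x in closedBall c r, |g x - ⨍ y in closedBall c (r / 6), g y|
      ≤ 2 * localToGlobalConst n * ε := by
  have hint := h.integrableOn c r hr hU
  have hM : ∀ k : ℕ, -(k : ℝ) ≤ k := fun k => by linarith [k.cast_nonneg (α := ℝ)]
  set G : ℕ → (Fin n → ℝ) → ℝ := fun k x => (Set.projIcc (-(k : ℝ)) k (hM k) (g x) : ℝ) with hG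
  have hGloc : ∀ k, LocalOscLE U (G k) (2 * ε) := fun k => h.clamp k.cast_nonneg
  have hGint : ∀ k, IntegrableOn (G k) (closedBall c r) :=
    fun k => (hGloc k).integrableOn c r hr hU
  have hdiff : ∀ k, IntegrableOn (fun x => |g x - G k x|) (closedBall c r) :=
    fun k => (hint.sub (hGint k)).abs
  have hproj : ∀ k x, |g x - G k x| ≤ |g x| := by
    intro k x
    have hk := k.cast_nonneg (α := ℝ)
    simp only [hG, Set.coe_projIcc]
    grind
  have hlim : Tendsto (fun k => ⨍ x in closedBall c r, |g x - G k x|) atTop (𝓝 0) := by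
    simp only [average_closedBall_eq c hr.le]
    rw [← mul_zero ((2 * r) ^ n)⁻¹]
    refine Tendsto.const_mul _ ?_
    rw [← integral_zero (Fin n → ℝ) ℝ (μ := volume.restrict (closedBall c r))]
    refine tendsto_integral_of_dominated_convergence (fun x => |g x|)
      (fun k => (hdiff k).aestronglyMeasurable) hint.abs
      (fun k => Eventually.of_forall fun x => by simpa using hproj k x)
      (Eventually.of_forall fun x => ?_)
    refine tendsto_const_nhds.congr' ?_
    filter_upwards [eventually_ge_atTop ⌈|g x|⌉₊] with k hk
    have hk' : |g x| ≤ k := (Nat.le_ceil _).trans (by exact_mod_cast hk)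
    simp only [hG]
    rw [Set.projIcc_of_mem (hM k) (abs_le.1 hk')]
    simp
  have hbound : ∀ k, ⨍ x in closedBall c r, |g x - ⨍ y in closedBall c (r / 6), g y| ≤
      (1 + 6 ^ n) * (⨍ x in closedBall c r, |g x - G k x|) + 2 * localToGlobalConst n * ε := by
    intro k
    have hsub : closedBall c (r / 6) ⊆ closedBall c r :=
      closedBall_subset_closedBall (by linarith)
    set a := ⨍ y in closedBall c (r / 6), g y with ha
    set b := ⨍ y in closedBall c (r / 6), G k y with hb
    have h₁ := (hGloc k).average_abs_sub_core_le_of_bounded (M := k)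
      (fun x => abs_le.2 (Set.projIcc (-(k : ℝ)) k (hM k) (g x)).2) hr hU
    have h₂ : |a - b| ≤ 6 ^ n * ⨍ x in closedBall c r, |g x - G k x| := by
      have e := average_closedBall_sub (by positivity : 0 ≤ r / 6) (hint.mono_set hsub)
        ((hGint k).mono_set hsub)
      have e₁ := abs_average_closedBall_sub_le (by positivity : 0 < r / 6)
        ((hint.sub (hGint k)).mono_set hsub) 0
      simp only [Pi.sub_apply, sub_zero] at e₁
      rw [e] at e₁
      have e₂ := average_closedBall_le_of_subset (by positivity : 0 < r / 6) hr hsub (hdiff k)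
        fun _ => abs_nonneg _
      rw [show r / (r / 6) = 6 by field_simp] at e₂
      exact e₁.trans e₂
    have h₃ := average_closedBall_mono hr.le (integrableOn_abs_sub hint a)
      (((hdiff k).add (integrableOn_abs_sub (hGint k) b)).add
        (integrableOn_closedBall_const c r |b - a|))
      (fun x _ => (abs_sub_le (g x) b a).trans
        (add_le_add_left (abs_sub_le (g x) (G k x) b) _))
    simp only [Pi.add_apply] at h₃
    have h₄ := average_closedBall_add hr.le ((hdiff k).add (integrableOn_abs_sub (hGint k) b))
      (integrableOn_closedBall_const c r |b - a|)
    have h₅ := average_closedBall_add hr.le (hdiff k) (integrableOn_abs_sub (hGint k) b)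
    simp only [Pi.add_apply] at h₄
    rw [h₄, h₅, average_closedBall_const c hr, abs_sub_comm b a] at h₃
    linarith
  have := ge_of_tendsto' ((hlim.const_mul (1 + 6 ^ n)).add_const
    (2 * localToGlobalConst n * ε)) hbound
  simpa using this

end LocalOscLE

end LocalToGlobal

section Cutoff

variable {w : ℝ → ℝ} {b L : ℝ}

lemma exists_le_intervalIntegral_of_lintegral_eq_top (hbL : b < L)
    (hw : AntitoneOn w (Set.Ioo 0 L)) (hw0 : ∀ s ∈ Set.Ioo 0 L, 0 ≤ w s)
    (htop : ∫⁻ s in Set.Ioo 0 b, ENNReal.ofReal (w s) = ⊤) {t : ℝ} (ht : 0 < t) (htb : t ≤ b)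
    (K : ℝ) : ∃ δ ∈ Set.Ioo 0 t, K ≤ ∫ s in δ..t, w s := by
  by_contra! hK
  have hcomp : ∀ δ, 0 < δ → IntegrableOn w (Set.Icc δ b) := fun δ hδ =>
    (hw.mono fun s hs => ⟨hδ.trans_le hs.1, hs.2.trans_lt hbL⟩).integrableOn_isCompact
      isCompact_Icc
  have ha : ∀ i : ℕ, t / (i + 2) ∈ Set.Ioo 0 t := fun i =>
    ⟨by positivity, div_lt_self ht (by linarith [i.cast_nonneg (α := ℝ)])⟩
  have hlim : Tendsto (fun i : ℕ => t / ((i : ℝ) + 2)) atTop (𝓝 0) :=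
    tendsto_const_nhds.div_atTop
      (tendsto_atTop_add_const_right _ _ tendsto_natCast_atTop_atTop)
  have h0t : IntegrableOn w (Set.Ioc 0 t) := by
    refine integrableOn_Ioc_of_intervalIntegral_norm_bounded_left (l := atTop) (I := K)
      (a := fun i : ℕ => t / ((i : ℝ) + 2)) (fun i => (hcomp _ (ha i).1).mono_set
        fun s hs => ⟨hs.1.le, hs.2.trans htb⟩) hlim (Eventually.of_forall fun i => ?_)
    rw [setIntegral_congr_fun measurableSet_Ioc (g := w) fun s hs => ?_,
      ← intervalIntegral.integral_of_le (ha i).2.le]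
    · exact (hK _ (ha i)).le
    · exact Real.norm_of_nonneg (hw0 s ⟨(ha i).1.trans hs.1, (hs.2.trans htb).trans_lt hbL⟩)
  have h0b : IntegrableOn w (Set.Ioo 0 b) := by
    refine (h0t.union (hcomp t ht)).mono_set fun s hs => ?_
    rcases le_total s t with h | h
    · exact Or.inl ⟨hs.1, h⟩
    · exact Or.inr ⟨h, hs.2.le⟩
  exact h0b.lintegral_lt_top.ne htop

/-- A cutoff function, equal to `1` near `0` and to `0` beyond `t`, whose modulus of continuity is
controlled by a decreasing weight with divergent integral at `0`. -/
lemma exists_cutoff (hbL : b < L) (hw : AntitoneOn w (Set.Ioo 0 L))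
    (hw0 : ∀ s ∈ Set.Ioo 0 L, 0 ≤ w s)
    (htop : ∫⁻ s in Set.Ioo 0 b, ENNReal.ofReal (w s) = ⊤) {t : ℝ} (ht : 0 < t) (htb : t ≤ b)
    {ε : ℝ} (hε : 0 < ε) :
    ∃ H : ℝ → ℝ, ∃ δ > 0, Continuous H ∧ (∀ s, 0 ≤ H s) ∧ (∀ s, H s ≤ 1) ∧
      (∀ s ≤ δ, H s = 1) ∧ (∀ s, t ≤ s → H s = 0) ∧
      ∀ m, 0 < m → m ≤ t → ∀ x y, m ≤ x → m ≤ y → |H x - H y| ≤ ε * w m * |x - y| := by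
  obtain ⟨δ, hδ, hint⟩ := exists_le_intervalIntegral_of_lintegral_eq_top hbL hw hw0 htop ht htb ε⁻¹
  have hint' : 1 ≤ ε * ∫ s in δ..t, w s := by
    rwa [inv_le_iff_one_le_mul₀' hε] at hint
  set p : ℝ → ℝ := fun s => (Set.projIcc δ t hδ.2.le s : ℝ) with hp
  have hpmem : ∀ s, p s ∈ Set.Icc δ t := fun s => (Set.projIcc δ t hδ.2.le s).2
  have hL : ∀ s, δ ≤ s → s ≤ t → s ∈ Set.Ioo 0 L :=
    fun s h₁ h₂ => ⟨hδ.1.trans_le h₁, (h₂.trans htb).trans_lt hbL⟩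
  have hii : ∀ x ∈ Set.Icc δ t, ∀ y ∈ Set.Icc δ t, IntervalIntegrable w volume x y := by
    intro x hx y hy
    refine AntitoneOn.intervalIntegrable (hw.mono fun s hs => ?_)
    have := Set.uIcc_subset_Icc hx hy hs
    exact hL s this.1 this.2
  set G : ℝ → ℝ := fun s => ∫ u in (p s)..t, w u with hG
  have hG0 : ∀ s, 0 ≤ G s := fun s => intervalIntegral.integral_nonneg (hpmem s).2
    fun u hu => hw0 u (hL u ((hpmem s).1.trans hu.1) hu.2)
  have hsub : ∀ x y, G x - G y = ∫ u in (p x)..(p y), w u := by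
    intro x y
    have := intervalIntegral.integral_add_adjacent_intervals (hii _ (hpmem x) _ (hpmem y))
      (hii _ (hpmem y) _ ⟨hδ.2.le, le_rfl⟩)
    simp only [hG]
    linarith
  have hmod : ∀ m, 0 < m → m ≤ t → ∀ x y, m ≤ p x → m ≤ p y →
      |min 1 (ε * G x) - min 1 (ε * G y)| ≤ ε * w m * |x - y| := by
    intro m hm hmt x y hx hy
    have hwm : 0 ≤ w m := hw0 m ⟨hm, (hmt.trans htb).trans_lt hbL⟩
    have h₁ : |G x - G y| ≤ w m * |p y - p x| := by
      rw [hsub, ← Real.norm_eq_abs]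
      refine intervalIntegral.norm_integral_le_of_norm_le_const fun u hu => ?_
      have hu₁ := Set.uIcc_subset_Icc (hpmem x) (hpmem y) (Set.uIoc_subset_uIcc hu)
      have huL := hL u hu₁.1 hu₁.2
      have hmu : m ≤ u := (le_min hx hy).trans (Set.uIoc_subset_uIcc hu).1
      rw [Real.norm_of_nonneg (hw0 u huL)]
      exact hw ⟨hm, (hmt.trans htb).trans_lt hbL⟩ huL hmu
    have h₂ : |p y - p x| ≤ |x - y| := by
      rw [abs_sub_comm x y]; exact Set.abs_projIcc_sub_projIcc hδ.2.le
    calc |min 1 (ε * G x) - min 1 (ε * G y)| ≤ |ε * G x - ε * G y| := by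
          refine (abs_min_sub_min_le_max _ _ _ _).trans ?_
          simp
      _ = ε * |G x - G y| := by rw [← mul_sub, abs_mul, abs_of_pos hε]
      _ ≤ ε * (w m * |x - y|) := by gcongr; exact h₁.trans (by gcongr)
      _ = ε * w m * |x - y| := by ring
  refine ⟨fun s => min 1 (ε * G s), δ, hδ.1, ?_, fun s => le_min zero_le_one
    (mul_nonneg hε.le (hG0 s)), fun s => min_le_left _ _, fun s hs => ?_, fun s hs => ?_,
    fun m hm hmt x y hx hy => ?_⟩
  · refine (LipschitzWith.of_dist_le_mul (K := (ε * w δ).toNNReal) fun x y => ?_).continuous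
    rw [Real.coe_toNNReal _ (mul_nonneg hε.le (hw0 δ (hL δ le_rfl hδ.2.le))), Real.dist_eq,
      Real.dist_eq]
    exact hmod δ hδ.1 hδ.2.le x y (hpmem x).1 (hpmem y).1
  · have : p s = δ := by simp only [hp]; rw [Set.projIcc_of_le_left _ hs]
    simp only [hG, this]
    exact min_eq_left hint'
  · have : p s = t := by simp only [hp]; rw [Set.projIcc_of_right_le _ hs]
    simp [hG, this]
  · have hmp : ∀ x, m ≤ x → m ≤ p x := fun x hx => by
      simp only [hp, Set.coe_projIcc]
      exact le_max_of_le_right (le_min hmt hx)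
    exact hmod m hm hmt x y (hmp x hx) (hmp y hy)

end Cutoff

section BoundaryApproximation

lemma average_closedBall_le_of_forall_le {c : Fin n → ℝ} {r : ℝ} (hr : 0 < r)
    {g : (Fin n → ℝ) → ℝ} (hg : IntegrableOn g (closedBall c r)) {K : ℝ}
    (hK : ∀ x ∈ closedBall c r, g x ≤ K) : ⨍ x in closedBall c r, g x ≤ K :=
  (average_closedBall_mono hr.le hg (integrableOn_closedBall_const c r K) hK).trans_eq
    (average_closedBall_const c hr K)

lemma Cube.osc_nonneg_s11 (Q : Cube n) (f : (Fin n → ℝ) → ℝ) : 0 ≤ Q.osc f :=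
  average_closedBall_nonneg Q.half_pos.le fun _ => abs_nonneg _

lemma Cube.avgAbs_nonneg_s11 (Q : Cube n) (f : (Fin n → ℝ) → ℝ) : 0 ≤ Q.avgAbs f :=
  average_closedBall_nonneg Q.half_pos.le fun _ => abs_nonneg _

lemma bigAvgSup_nonneg (U : Set (Fin n → ℝ)) (lam : ℝ) (f : (Fin n → ℝ) → ℝ) :
    0 ≤ bigAvgSup U lam f :=
  Real.sSup_nonneg fun _ ⟨Q, _, _, hr⟩ => hr ▸ Q.avgAbs_nonneg_s11 f

lemma bmoNorm_nonneg (U : Set (Fin n → ℝ)) (lam : ℝ) (f : (Fin n → ℝ) → ℝ) :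
    0 ≤ bmoNorm U lam f :=
  add_nonneg (Real.sSup_nonneg fun _ ⟨Q, _, _, hr⟩ => hr ▸ Q.osc_nonneg_s11 f)
    (bigAvgSup_nonneg U lam f)

lemma MemBmo.osc_le_bmoNorm {U V : Set (Fin n → ℝ)} {lam : ℝ} {f : (Fin n → ℝ) → ℝ}
    (hf : MemBmo U lam f) (hVU : V ⊆ U) {Q : Cube n} (hQ : Q.toSet ⊆ V) (hside : Q.side < lam) :
    Q.osc f ≤ bmoNorm V lam f := by
  have hbdd : BddAbove {r | ∃ Q : Cube n, Q.toSet ⊆ V ∧ Q.side < lam ∧ r = Q.osc f} :=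
    hf.2.1.mono (by rintro _ ⟨Q, hQ, hs, rfl⟩; exact ⟨Q, hQ.trans hVU, hs, rfl⟩)
  have : Q.osc f ≤ omegaOn V f lam := le_csSup hbdd ⟨Q, hQ, hside, rfl⟩
  exact this.trans (le_add_of_nonneg_right (bigAvgSup_nonneg V lam f))

lemma bmoNorm_le {U : Set (Fin n → ℝ)} {lam : ℝ} {g : (Fin n → ℝ) → ℝ} {A B : ℝ}
    (hA : 0 ≤ A) (hB : 0 ≤ B) (hosc : ∀ Q : Cube n, Q.toSet ⊆ U → Q.side < lam → Q.osc g ≤ A)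
    (havg : ∀ Q : Cube n, Q.toSet ⊆ U → lam ≤ Q.side → Q.avgAbs g ≤ B) :
    bmoNorm U lam g ≤ A + B :=
  add_le_add (Real.sSup_le (fun _ ⟨Q, hQ, hs, hr⟩ => hr ▸ hosc Q hQ hs) hA)
    (Real.sSup_le (fun _ ⟨Q, hQ, hs, hr⟩ => hr ▸ havg Q hQ hs) hB)

lemma le_distBd_of_closedBall_subset {U : Set (Fin n → ℝ)} (hU : IsOpen U)
    (hne : (frontier U).Nonempty) {c : Fin n → ℝ} {ρ : ℝ} (hsub : closedBall c ρ ⊆ U)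
    (x : Fin n → ℝ) : ρ - dist x c ≤ distBd U x := by
  refine (le_infDist hne).2 fun y hy => ?_
  rw [hU.frontier_eq] at hy
  have : ρ < dist y c := not_le.1 fun h => hy.2 (hsub h)
  linarith [dist_triangle y x c, dist_comm x y]

lemma abs_distBd_sub_le (U : Set (Fin n → ℝ)) (x y : Fin n → ℝ) :
    |distBd U x - distBd U y| ≤ dist x y := by
  have := (lipschitz_infDist_pt (frontier U)).dist_le_mul x y
  simpa [Real.dist_eq, distBd] using this

lemma continuous_distBd (U : Set (Fin n → ℝ)) : Continuous (distBd U) :=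
  continuous_infDist_pt _

lemma LocalOscLE.osc_cube_le {U : Set (Fin n → ℝ)} {g : (Fin n → ℝ) → ℝ} {ε : ℝ}
    (h : LocalOscLE U g ε) {Q : Cube n} (hQ : Q.toSet ⊆ U) :
    Q.osc g ≤ 4 * localToGlobalConst n * ε := by
  have h₁ := average_abs_sub_average_le Q.half_pos (h.integrableOn _ _ Q.half_pos hQ)
    (⨍ y in closedBall Q.center (Q.half / 6), g y)
  have h₂ := h.average_abs_sub_core_le Q.half_pos hQ
  exact h₁.trans (by linarith)

/-- Multiplying `f` by a cutoff adapted to the growth of its averages near the boundary yields a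
function of small local oscillation. -/
lemma localOscLE_mul_cutoff {U : Set (Fin n → ℝ)} (hU : IsOpen U)
    (hne : (frontier U).Nonempty) {lam : ℝ} {f : (Fin n → ℝ) → ℝ} (hf : MemBmo U lam f)
    {φ : ℝ → ℝ} (hφpos : ∀ t ∈ Set.Ioo (0:ℝ) (lam/2), 0 < φ t) {C : ℝ}
    (hbound : ∀ Q : Cube n, Q.double.toSet ⊆ U →
      (∃ q ∈ Q.toSet, distBd U q < lam/4) → |Q.avg f| ≤ C * φ Q.side)
    {t α ε : ℝ} (htl : t ≤ lam / 4) (hα : 0 ≤ α) (hε : 0 < ε)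
    (hsmall : bmoNorm (U \ innerPart U (2 * t)) lam f ≤ α)
    {H : ℝ → ℝ} (hHc : Continuous H) (hH0 : ∀ s, 0 ≤ H s) (hH1 : ∀ s, H s ≤ 1)
    (hHt : ∀ s, t ≤ s → H s = 0)
    (hH : ∀ m, 0 < m → m ≤ t → ∀ x y, m ≤ x → m ≤ y →
      |H x - H y| ≤ ε * (1 / (m * φ m)) * |x - y|) :
    LocalOscLE U (fun x => f x * H (distBd U x)) (2 * (α + |C| * ε / 2)) := by
  have hint : ∀ c r, 0 < r → closedBall c r ⊆ U →
      IntegrableOn (fun x => f x * H (distBd U x)) (closedBall c r) := fun c r hr hsub =>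
    Integrable.mul_bdd (c := 1) (hf.1 ⟨c, r, hr⟩ hsub)
      (hHc.comp (continuous_distBd U)).aestronglyMeasurable
      (Eventually.of_forall fun x => by
        rw [Real.norm_of_nonneg (hH0 _)]; exact hH1 _)
  refine ⟨hint, fun c r hr hsub => ?_⟩
  have hsub' : closedBall c r ⊆ U := (closedBall_subset_closedBall (by linarith)).trans hsub
  have hfint : IntegrableOn f (closedBall c r) := hf.1 ⟨c, r, hr⟩ hsub'
  have hgint := hint c r hr hsub'
  set A := ⨍ y in closedBall c r, f y with hA
  refine (average_abs_sub_average_le hr hgint (A * H (distBd U c))).trans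
    (mul_le_mul_of_nonneg_left ?_ zero_le_two)
  have hD : 0 ≤ |C| * ε / 2 := by positivity
  by_cases hfar : ∀ x ∈ closedBall c r, t ≤ distBd U x
  · refine average_closedBall_le_of_forall_le hr (integrableOn_abs_sub hgint _) fun x hx => ?_
    rw [hHt _ (hfar x hx), hHt _ (hfar c (mem_closedBall_self hr.le))]
    simpa using add_nonneg hα hD
  push Not at hfar
  obtain ⟨x₀, hx₀, hx₀t⟩ := hfar
  have hlow : ∀ x ∈ closedBall c r, 2 * r ≤ distBd U x := fun x hx => by
    have := le_distBd_of_closedBall_subset hU hne hsub x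
    have hx := mem_closedBall.1 hx
    linarith
  have hrt : 2 * r < t := (hlow x₀ hx₀).trans_lt hx₀t
  have hrl : 2 * r ∈ Set.Ioo 0 (lam / 2) := ⟨by linarith, by linarith⟩
  have hφr := hφpos _ hrl
  have hlayer : closedBall c r ⊆ U \ innerPart U (2 * t) := fun x hx => by
    refine ⟨hsub' hx, fun hx' => ?_⟩
    have h₁ := (abs_le.1 (abs_distBd_sub_le U x x₀)).2
    have h₂ := dist_triangle_right x x₀ c
    have := hx'.2
    have hx := mem_closedBall.1 hx
    have hx₀ := mem_closedBall.1 hx₀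
    linarith
  have hosc : ⨍ x in closedBall c r, |f x - A| ≤ α :=
    (hf.osc_le_bmoNorm Set.sdiff_subset (Q := ⟨c, r, hr⟩) hlayer
      (show 2 * r < lam by linarith)).trans hsmall
  have hAle : |A| ≤ |C| * φ (2 * r) :=
    (hbound ⟨c, r, hr⟩ (show closedBall c (2 * r) ⊆ U from
      (closedBall_subset_closedBall (by linarith)).trans hsub)
      ⟨x₀, hx₀, hx₀t.trans_le htl⟩).trans
      (mul_le_mul_of_nonneg_right (le_abs_self C) hφr.le)
  have hvar : ∀ x ∈ closedBall c r, |A| * |H (distBd U x) - H (distBd U c)| ≤ |C| * ε / 2 := by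
    intro x hx
    have h₁ := hH (2 * r) hrl.1 hrt.le _ _ (hlow x hx) (hlow c (mem_closedBall_self hr.le))
    have h₂ : |distBd U x - distBd U c| ≤ r := (abs_distBd_sub_le U x c).trans hx
    have h₃ : |H (distBd U x) - H (distBd U c)| ≤ ε * (1 / (2 * r * φ (2 * r))) * r :=
      h₁.trans (by gcongr)
    calc |A| * |H (distBd U x) - H (distBd U c)|
        ≤ (|C| * φ (2 * r)) * (ε * (1 / (2 * r * φ (2 * r))) * r) := by gcongr
      _ = |C| * ε / 2 := by field_simp
  refine (average_closedBall_mono hr.le (integrableOn_abs_sub hgint _)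
    ((integrableOn_abs_sub hfint A).add (integrableOn_closedBall_const c r (|C| * ε / 2)))
    fun x hx => ?_).trans ?_
  · calc |f x * H (distBd U x) - A * H (distBd U c)|
        = |(f x - A) * H (distBd U x) + A * (H (distBd U x) - H (distBd U c))| := by ring_nf
      _ ≤ |f x - A| * H (distBd U x) + |A| * |H (distBd U x) - H (distBd U c)| := by
          refine (abs_add_le _ _).trans_eq ?_
          rw [abs_mul, abs_mul, abs_of_nonneg (hH0 _)]
      _ ≤ |f x - A| + |C| * ε / 2 :=
          add_le_add (mul_le_of_le_one_right (abs_nonneg _) (hH1 _)) (hvar x hx)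
  · have := average_closedBall_add hr.le (integrableOn_abs_sub hfint A)
      (integrableOn_closedBall_const c r (|C| * ε / 2))
    rw [average_closedBall_const c hr] at this
    exact this.trans_le (by linarith)

lemma MemBmo.sub {U : Set (Fin n → ℝ)} {lam : ℝ} {f g : (Fin n → ℝ) → ℝ}
    (hf : MemBmo U lam f) (hg : MemBmo U lam g) : MemBmo U lam (f - g) := by
  refine ⟨fun Q hQ => (hf.1 Q hQ).sub (hg.1 Q hQ), ?_, ?_⟩
  · obtain ⟨A, hA⟩ := hf.2.1
    obtain ⟨B, hB⟩ := hg.2.1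
    refine ⟨A + B, ?_⟩
    rintro _ ⟨Q, hQ, hs, rfl⟩
    have hfQ := hA ⟨Q, hQ, hs, rfl⟩
    have hgQ := hB ⟨Q, hQ, hs, rfl⟩
    have hfi : IntegrableOn f (closedBall Q.center Q.half) := hf.1 Q hQ
    have hgi : IntegrableOn g (closedBall Q.center Q.half) := hg.1 Q hQ
    have havg : Q.avg (f - g) = Q.avg f - Q.avg g :=
      average_closedBall_sub Q.half_pos.le hfi hgi
    refine le_trans ?_ (add_le_add hfQ hgQ)
    refine (average_closedBall_mono Q.half_pos.le (integrableOn_abs_sub (hfi.sub hgi) _)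
      ((integrableOn_abs_sub hfi (Q.avg f)).add (integrableOn_abs_sub hgi (Q.avg g)))
      fun x _ => ?_).trans_eq (average_closedBall_add Q.half_pos.le
        (integrableOn_abs_sub hfi _) (integrableOn_abs_sub hgi _))
    rw [havg]
    refine le_trans (le_of_eq ?_) (abs_sub (f x - Q.avg f) (g x - Q.avg g))
    simp only [Pi.sub_apply]
    ring_nf
  · obtain ⟨A, hA⟩ := hf.2.2
    obtain ⟨B, hB⟩ := hg.2.2
    refine ⟨A + B, ?_⟩
    rintro _ ⟨Q, hQ, hs, rfl⟩
    have hfi : IntegrableOn f (closedBall Q.center Q.half) := hf.1 Q hQ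
    have hgi : IntegrableOn g (closedBall Q.center Q.half) := hg.1 Q hQ
    refine le_trans ?_ (add_le_add (hA ⟨Q, hQ, hs, rfl⟩) (hB ⟨Q, hQ, hs, rfl⟩))
    exact (average_closedBall_mono Q.half_pos.le (hfi.sub hgi).abs (hfi.abs.add hgi.abs)
      fun x _ => abs_sub _ _).trans_eq (average_closedBall_add Q.half_pos.le hfi.abs hgi.abs)

/-- A function vanishing at the boundary, whose averages grow slowly enough there, is
approximated in `bmo` by functions supported away from the boundary. -/
lemma exists_suppAway_bmoNorm_sub_le {Ω : Set (Fin n → ℝ)} (hΩ : IsOpen Ω)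
    {lam : ℝ} (hlam : 0 < lam) {f : (Fin n → ℝ) → ℝ} (hf : MemBmo Ω lam f)
    (hvan : VanishAtBoundary Ω lam f) {φ : ℝ → ℝ}
    (hφpos : ∀ t ∈ Set.Ioo (0:ℝ) (lam/2), 0 < φ t)
    (hφmono : MonotoneOn (fun t => t * φ t) (Set.Ioo (0:ℝ) (lam/2)))
    (hφint : ∫⁻ t in Set.Ioo (0:ℝ) (lam/4), ENNReal.ofReal (1 / (t * φ t)) = ⊤) {C : ℝ}
    (hbound : ∀ Q : Cube n, Q.double.toSet ⊆ Ω →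
      (∃ q ∈ Q.toSet, distBd Ω q < lam/4) → |Q.avg f| ≤ C * φ Q.side)
    {η : ℝ} (hη : 0 < η) :
    ∃ F : (Fin n → ℝ) → ℝ, MemBmo Ω lam F ∧ SuppAway Ω F ∧ bmoNorm Ω lam (f - F) ≤ η := by
  rcases (frontier Ω).eq_empty_or_nonempty with hemp | hne
  · refine ⟨f, hf, ⟨1, one_pos, by simp [hemp]⟩, ?_⟩
    rw [sub_self]
    refine (bmoNorm_le (A := 0) (B := 0) le_rfl le_rfl (fun Q _ _ => ?_)
      fun Q _ _ => ?_).trans (by linarith)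
    · simp [Cube.osc, Cube.avg]
    · simp [Cube.avgAbs]
  have hK := localToGlobalConst_pos n
  set K := localToGlobalConst n with hKdef
  set e := η / (6 * K) with he
  have he0 : 0 < e := by positivity
  obtain ⟨T, hT, hsmall⟩ := (mem_nhdsGT_iff_exists_Ioo_subset).1
    (hvan (Iio_mem_nhds (by positivity : 0 < e / 4)))
  have hT : 0 < T := hT
  set t := min (lam / 4) (T / 4) with ht
  have ht0 : 0 < t := lt_min (by positivity) (by positivity)
  have htl : t ≤ lam / 4 := min_le_left _ _
  have htT : t ≤ T / 4 := min_le_right _ _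
  set ε := e / (2 * (|C| + 1)) with hε
  have hε0 : 0 < ε := by positivity
  have hw0 : ∀ s ∈ Set.Ioo 0 (lam / 2), 0 < s * φ s := fun s hs => mul_pos hs.1 (hφpos s hs)
  obtain ⟨H, δ, hδ, hHc, hH0, hH1, hHδ, hHt, hH⟩ := exists_cutoff (w := fun s => 1 / (s * φ s))
    (by linarith : lam / 4 < lam / 2)
    (fun x hx y hy hxy => one_div_le_one_div_of_le (hw0 x hx) (hφmono hx hy hxy))
    (fun s hs => (one_div_pos.2 (hw0 s hs)).le) hφint ht0 htl hε0
  set g : (Fin n → ℝ) → ℝ := fun x => f x * H (distBd Ω x) with hg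
  have hloc : LocalOscLE Ω g e := by
    have h := localOscLE_mul_cutoff hΩ hne hf hφpos hbound htl
      (by positivity : 0 ≤ e / 4) hε0
      (le_of_lt (hsmall ⟨by positivity, by linarith⟩ : bmoNorm (Ω \ innerPart Ω (2 * t)) lam f < _))
      hHc hH0 hH1 hHt hH
    refine ⟨h.integrableOn, fun c r hr hsub => (h.osc_le c r hr hsub).trans ?_⟩
    have : |C| * ε ≤ e / 2 := by
      rw [hε, ← mul_div_assoc, div_le_iff₀ (by positivity)]
      nlinarith [abs_nonneg C]
    linarith
  have hosc : ∀ Q : Cube n, Q.toSet ⊆ Ω → Q.side < lam → Q.osc g ≤ 4 * K * e :=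
    fun Q hQ _ => hloc.osc_cube_le hQ
  have havg : ∀ Q : Cube n, Q.toSet ⊆ Ω → lam ≤ Q.side → Q.avgAbs g ≤ 2 * K * e := by
    intro Q hQ hs
    have hr := Q.half_pos
    have hs : lam ≤ 2 * Q.half := hs
    have hcore : ⨍ y in closedBall Q.center (Q.half / 6), g y = 0 := by
      rw [average_closedBall_eq _ (by positivity), setIntegral_congr_fun (g := fun _ => 0)
        measurableSet_closedBall, integral_zero, mul_zero]
      intro x hx
      have h₁ := le_distBd_of_closedBall_subset hΩ hne hQ x
      have hx := mem_closedBall.1 hx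
      simp only [hg]
      rw [hHt _ (by linarith), mul_zero]
    have := hloc.average_abs_sub_core_le hr hQ
    simp only [hcore, sub_zero] at this
    exact this
  have hgmem : MemBmo Ω lam g :=
    ⟨fun Q hQ => hloc.integrableOn _ _ Q.half_pos hQ,
      ⟨_, fun _ ⟨Q, hQ, hs, hr⟩ => hr ▸ hosc Q hQ hs⟩,
      ⟨_, fun _ ⟨Q, hQ, hs, hr⟩ => hr ▸ havg Q hQ hs⟩⟩
  refine ⟨f - g, hf.sub hgmem, ⟨δ, hδ, fun x hx y hy => ?_⟩, ?_⟩
  · have hδx : δ < distBd Ω x := by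
      by_contra! h
      exact hx (by simp [hg, hHδ _ h])
    exact hδx.le.trans (infDist_le_dist_of_mem hy)
  · rw [sub_sub_cancel]
    refine (bmoNorm_le (by positivity) (by positivity) hosc havg).trans (le_of_eq ?_)
    rw [he]
    field_simp
    norm_num

end BoundaryApproximation

/-- Lemma (vanishing at the boundary on a domain): if f ∈ bmo_λ(Ω) vanishes at the boundary
and |f_Q| ≲ φ_λ(ℓ(Q)) for cubes with 2Q ⊂ Ω near the boundary, for a suitable weight φ_λ,
then f is a bmo_λ(Ω)-limit of functions supported away from ∂Ω. -/
theorem stmt11 {n : ℕ} (hn : 0 < n) (Ω : Set (Fin n → ℝ)) (hΩ : IsRealDomain Ω)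
    (lam : ℝ) (hlam : 0 < lam) (f : (Fin n → ℝ) → ℝ)
    (hf : MemBmo Ω lam f)
    (hvan : VanishAtBoundary Ω lam f)
    (φ : ℝ → ℝ)
    (hφpos : ∀ t ∈ Set.Ioo (0:ℝ) (lam/2), 0 < φ t)
    (hφone : ∀ t ∈ Set.Ico (lam/4) (lam/2), φ t = 1)
    (hφmono : MonotoneOn (fun t => t * φ t) (Set.Ioo (0:ℝ) (lam/2)))
    (hφint : ∫⁻ t in Set.Ioo (0:ℝ) (lam/4), ENNReal.ofReal (1 / (t * φ t)) = ⊤)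
    (C : ℝ)
    (hbound : ∀ Q : Cube n, Q.double.toSet ⊆ Ω →
      (∃ q ∈ Q.toSet, distBd Ω q < lam/4) → |Q.avg f| ≤ C * φ Q.side) :
    ∃ F : ℕ → (Fin n → ℝ) → ℝ,
      (∀ j, MemBmo Ω lam (F j) ∧ SuppAway Ω (F j)) ∧
      Tendsto (fun j => bmoNorm Ω lam (f - F j)) atTop (nhds 0) := by
  choose F hF using fun j : ℕ => exists_suppAway_bmoNorm_sub_le hΩ.1 hlam hf hvan hφpos hφmono
    hφint hbound (Nat.one_div_pos_of_nat (α := ℝ) (n := j))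
  exact ⟨F, fun j => ⟨(hF j).1, (hF j).2.1⟩, squeeze_zero (fun j => bmoNorm_nonneg _ _ _)
    (fun j => (hF j).2.2) tendsto_one_div_add_atTop_nhds_zero_nat⟩
end
end
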